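/- There are exactly 372 (3,6) pseudo-GCOs on the label set {1,…,6}. (A (3,6) pseudo-GCO is a 6-tuple (σ^{(1)},…,σ^{(6)}), where σ^{(i)} is a (2,5) color ordering on {1,…,6}∖{i}, such that for every j ∈ {1,…,6} the projection π_j — obtained by deleting the component σ^{(j)} and deleting the label j from each of the remaining five orderings — is a (3,5) pseudo-GCO, i.e., the descendant of some (2,5) color ordering.) -/

import Mathlib

/-- Dihedral equivalence of lists: `l₂` is obtained from `l₁` by a rotation,
possibly composed with a reversal.  Two cyclic words represent the same
(2,m) color ordering iff they are dihedrally equivalent. -/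
def DihEquiv {α : Type*} (l₁ l₂ : List α) : Prop :=
  List.IsRotated l₁ l₂ ∨ List.IsRotated l₁.reverse l₂

theorem dihEquiv_refl {α : Type*} (l : List α) : DihEquiv l l :=
  Or.inl (List.IsRotated.refl l)

theorem dihEquiv_symm {α : Type*} {l₁ l₂ : List α} (h : DihEquiv l₁ l₂) : DihEquiv l₂ l₁ := by
  rcases h with h | h
  · exact Or.inl h.symm
  · have h2 := h.reverse
    rw [List.reverse_reverse] at h2
    exact Or.inr h2.symm

theorem dihEquiv_trans {α : Type*} {l₁ l₂ l₃ : List α} (h : DihEquiv l₁ l₂)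
    (h' : DihEquiv l₂ l₃) : DihEquiv l₁ l₃ := by
  rcases h with h | h <;> rcases h' with h' | h'
  · exact Or.inl (h.trans h')
  · exact Or.inr (h.reverse.trans h')
  · exact Or.inr (h.trans h')
  · have h2 := h.reverse
    rw [List.reverse_reverse] at h2
    exact Or.inl (h2.trans h')

/-- A `(k, S.card)` pre-GCO on the label set `S`, given by representatives: to every
`(k-2)`-element subset `I ⊆ S` it assigns a cyclic word on `S \ I` (a representative of
a `(2, S.card - k + 2)` color ordering).  Values of `σ` on other subsets are irrelevant. -/
def IsPreGCO (k : ℕ) (S : Finset ℕ) (σ : Finset ℕ → List ℕ) : Prop :=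
  ∀ I : Finset ℕ, I ⊆ S → I.card = k - 2 →
    (σ I).Nodup ∧ (σ I).toFinset = S \ I

/-- The recursive pseudo-GCO condition on a `(k, S.card)` pre-GCO (given by
representatives).  For `S.card = k + 2` it says that the pre-GCO is the descendant of a
`(2, k+2)` color ordering (represented by `base`); for `S.card > k + 2` it requires all
`k`-preserving projections (delete the component at subsets containing `i`, and delete
the label `i` from the remaining components) to be pseudo-GCOs. -/
def IsPseudoGCO (k : ℕ) (S : Finset ℕ) (σ : Finset ℕ → List ℕ) : Prop :=
  if S.card ≤ k + 2 then
    ∃ base : List ℕ, base.Nodup ∧ base.toFinset = S ∧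
      ∀ I : Finset ℕ, I ⊆ S → I.card = k - 2 →
        DihEquiv (σ I) (base.filter (fun x => x ∉ I))
  else
    ∀ i ∈ S, IsPseudoGCO k (S.erase i) (fun I => (σ I).filter (fun x => x ≠ i))
termination_by S.card
decreasing_by exact Finset.card_erase_lt_of_mem ‹_›

/-- Setoid identifying two `(k, S.card)` pre-GCO representatives when all of their
relevant components are dihedrally equivalent, i.e. when they represent the same
generalized color ordering. -/
def gcoSetoid (k : ℕ) (S : Finset ℕ) (P : (Finset ℕ → List ℕ) → Prop) :
    Setoid {σ : Finset ℕ → List ℕ // P σ} where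
  r σ τ := ∀ I : Finset ℕ, I ⊆ S → I.card = k - 2 → DihEquiv (σ.1 I) (τ.1 I)
  iseqv :=
    ⟨fun σ I _ _ => dihEquiv_refl (σ.1 I),
     fun h I hI hc => dihEquiv_symm (h I hI hc),
     fun h h' I hI hc => dihEquiv_trans (h I hI hc) (h' I hI hc)⟩

instance DihEquiv.instDecidable {α : Type*} [DecidableEq α] (l₁ l₂ : List α) :
    Decidable (DihEquiv l₁ l₂) :=
  inferInstanceAs (Decidable (_ ∨ _))

theorem List.IsRotated.filter {α : Type*} {l₁ l₂ : List α} (h : List.IsRotated l₁ l₂)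
    (p : α → Bool) : List.IsRotated (l₁.filter p) (l₂.filter p) := by
  obtain ⟨n, hn, rfl⟩ := List.isRotated_iff_mod.1 h
  rw [List.rotate_eq_drop_append_take hn, List.filter_append]
  conv_lhs => rw [← List.take_append_drop n l₁, List.filter_append]
  exact List.isRotated_append

theorem DihEquiv.filter {α : Type*} {l₁ l₂ : List α} (h : DihEquiv l₁ l₂) (p : α → Bool) :
    DihEquiv (l₁.filter p) (l₂.filter p) := by
  rcases h with h | h
  · exact Or.inl (h.filter p)
  · exact Or.inr (by simpa only [List.filter_reverse] using h.filter p)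

namespace SixLabels

/-- The label with index `i`. -/
def label (i : Fin 6) : ℕ := i + 1

/-- Representatives of the twelve cyclic orders on five letters. -/
def shapes : List (List ℕ) :=
  [[0, 1, 2, 3, 4], [0, 1, 2, 4, 3], [0, 1, 3, 2, 4], [0, 1, 3, 4, 2],
   [0, 1, 4, 2, 3], [0, 1, 4, 3, 2], [0, 2, 1, 3, 4], [0, 2, 1, 4, 3],
   [0, 2, 3, 1, 4], [0, 2, 4, 1, 3], [0, 3, 1, 2, 4], [0, 3, 2, 1, 4]]

/-- Representatives of the twelve color orderings on the labels other than `label i`; the letter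
`k` of a shape stands for the label `k + 1` steps after `label i` in the cycle `1, …, 6`. -/
def word (i : Fin 6) (a : Fin 12) : List ℕ :=
  (shapes.getD a []).map fun k => (i + 1 + k) % 6 + 1

theorem label_injective : Function.Injective label := by decide

theorem exists_label_of_mem {x : ℕ} (hx : x ∈ Finset.Icc 1 6) : ∃ i, label i = x := by
  rw [Finset.mem_Icc] at hx
  exact ⟨⟨x - 1, by omega⟩, by simp only [label]; omega⟩

theorem label_mem (i : Fin 6) : label i ∈ Finset.Icc 1 6 := by
  simp only [label, Finset.mem_Icc]; omega

theorem word_nodup (i : Fin 6) (a : Fin 12) : (word i a).Nodup := by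
  revert i a; decide +kernel

theorem word_toFinset (i : Fin 6) (a : Fin 12) :
    (word i a).toFinset = Finset.Icc 1 6 \ {label i} := by
  revert i a; decide +kernel

theorem eq_of_dihEquiv_word {i : Fin 6} {a b : Fin 12} (h : DihEquiv (word i a) (word i b)) :
    a = b := by
  revert i a b; decide +kernel

theorem exists_dihEquiv_word {i : Fin 6} {l : List ℕ} (hl : l.Nodup)
    (hs : l.toFinset = Finset.Icc 1 6 \ {label i}) : ∃ a, DihEquiv l (word i a) := by
  have hmem : l ∈ (word i 0).permutations' :=
    List.mem_permutations'.2 <| List.perm_of_nodup_nodup_toFinset_eq hl (word_nodup i 0)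
      (hs.trans (word_toFinset i 0).symm)
  have key : ∀ i, ∀ l ∈ (word i 0).permutations', ∃ a, DihEquiv l (word i a) := by
    decide +kernel
  exact key i l hmem

/-- The orderings `word i a` and `word j b` have the same restriction to the labels other than
`label i` and `label j`. -/
def Compatible (i : Fin 6) (a : Fin 12) (j : Fin 6) (b : Fin 12) : Prop :=
  DihEquiv ((word i a).filter (· ≠ label j)) ((word j b).filter (· ≠ label i))

instance (i : Fin 6) (a : Fin 12) (j : Fin 6) (b : Fin 12) : Decidable (Compatible i a j b) :=
  inferInstanceAs (Decidable (DihEquiv _ _))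

/-- The choice of the components `word i (f i)` is a pseudo-GCO. -/
def IsConsistent (f : Fin 6 → Fin 12) : Prop :=
  ∀ j, ∃ b, ∀ i, i ≠ j → Compatible i (f i) j b

/-- The shapes compatible with the component `word 0 a`: bit `12 * j + b` says whether
`word j b` is compatible with it. -/
def zeroMask (a : Fin 12) : ℕ :=
  [0x8a116104d407813fff, 0x8a11610b29c012cfff, 0x44a16104d2386c0fff, 0x44ac1404d9c012cfff,
   0x8a1c140b22386c0fff, 0x44ac140b2407813fff, 0x31428a04d40712cfff, 0x31428a0b29c0813fff,
   0x44a28af004076c0fff, 0x314c14f009c06c0fff, 0x314161f0023812cfff,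
   0x8a128af00238813fff].getD a 0

/-- The same for `word i a`, obtained by rotating the labels. -/
def mask (i : Fin 6) (a : Fin 12) : ℕ :=
  (zeroMask a * (2 ^ 72 + 1)) >>> (72 - 12 * (i : ℕ))

theorem testBit_mask (i : Fin 6) (a : Fin 12) (j : Fin 6) (b : Fin 12) :
    (mask i a).testBit (12 * j + b) = true ↔ (i ≠ j → Compatible i a j b) := by
  revert i a j b; decide +kernel

/-- Each of the six blocks of twelve bits of `s` is nonzero. -/
def Live (s : ℕ) : Prop := ∀ j : Fin 6, (s >>> (12 * (j : ℕ))) % 2 ^ 12 ≠ 0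

instance (s : ℕ) : Decidable (Live s) := inferInstanceAs (Decidable (∀ _, _))

theorem live_iff {s : ℕ} : Live s ↔ ∀ j : Fin 6, ∃ b : Fin 12, s.testBit (12 * j + b) = true := by
  refine forall_congr' fun j => ⟨fun h => ?_, fun ⟨b, hb⟩ h => ?_⟩
  · obtain ⟨b, hb⟩ := Nat.exists_testBit_of_ne_zero h
    simp only [Nat.testBit_mod_two_pow, Nat.testBit_shiftRight, Bool.and_eq_true,
      decide_eq_true_eq] at hb
    exact ⟨⟨b, hb.1⟩, hb.2⟩
  · have hbit := Nat.testBit_mod_two_pow (s >>> (12 * (j : ℕ))) 12 b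
    rw [h, Nat.testBit_shiftRight, hb] at hbit
    simp at hbit

theorem Live.of_land {s t : ℕ} (h : Live (s &&& t)) : Live s := by
  rw [live_iff] at h ⊢
  intro j
  obtain ⟨b, hb⟩ := h j
  rw [Nat.testBit_land, Bool.and_eq_true] at hb
  exact ⟨b, hb.1⟩

/-- Intersection of `s` with all masks `M i (f i)`. -/
def meet : {n : ℕ} → (Fin n → Fin 12 → ℕ) → ℕ → (Fin n → Fin 12) → ℕ
  | 0, _, s, _ => s
  | _ + 1, M, s, f => meet (fun i => M i.succ) (s &&& M 0 (f 0)) (fun i => f i.succ)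

theorem testBit_meet {n : ℕ} (M : Fin n → Fin 12 → ℕ) (s : ℕ) (f : Fin n → Fin 12) (k : ℕ) :
    (meet M s f).testBit k = true ↔
      s.testBit k = true ∧ ∀ i, (M i (f i)).testBit k = true := by
  induction n generalizing s with
  | zero => simp [meet]
  | succ n ih => simp [meet, ih, Fin.forall_fin_succ, and_assoc]

theorem Live.of_meet {n : ℕ} {M : Fin n → Fin 12 → ℕ} {s : ℕ} {f : Fin n → Fin 12}
    (h : Live (meet M s f)) : Live s := by
  induction n generalizing s with
  | zero => exact h
  | succ n ih => exact (ih h).of_land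

/-- Backtracking count of the `f` for which `meet M s f` is live. -/
def count : {n : ℕ} → (Fin n → Fin 12 → ℕ) → ℕ → ℕ
  | 0, _, _ => 1
  | _ + 1, M, s => ((List.finRange 12).map fun a =>
      if Live (s &&& M 0 a) then count (fun i => M i.succ) (s &&& M 0 a) else 0).sum

theorem card_live_meet {n : ℕ} (M : Fin n → Fin 12 → ℕ) {s : ℕ} (hs : Live s) :
    Nat.card {f : Fin n → Fin 12 // Live (meet M s f)} = count M s := by
  induction n generalizing s with
  | zero =>
    have : Unique {f : Fin 0 → Fin 12 // Live (meet M s f)} :=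
      { default := ⟨Fin.elim0, hs⟩, uniq := fun f => Subtype.ext (Subsingleton.elim _ _) }
    simp [count]
  | succ n ih =>
    let e : {f : Fin (n + 1) → Fin 12 // Live (meet M s f)} ≃
        Σ a : Fin 12, {f : Fin n → Fin 12 // Live (meet (fun i => M i.succ) (s &&& M 0 a) f)} :=
      { toFun f := ⟨f.1 0, fun i => f.1 i.succ, f.2⟩
        invFun p := ⟨Fin.cons p.1 p.2.1, p.2.2⟩
        left_inv f := Subtype.ext (Fin.cons_self_tail f.1)
        right_inv p := rfl }
    rw [Nat.card_congr e, Nat.card_sigma, Fin.sum_univ_def, count]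
    congr 2
    funext a
    split_ifs with h
    · exact ih _ h
    · have : IsEmpty {f : Fin n → Fin 12 //
          Live (meet (fun i => M i.succ) (s &&& M 0 a) f)} := ⟨fun f => h f.2.of_meet⟩
      exact Nat.card_of_isEmpty

theorem isConsistent_iff {f : Fin 6 → Fin 12} :
    IsConsistent f ↔ Live (meet mask (2 ^ 72 - 1) f) := by
  simp only [IsConsistent, live_iff, testBit_meet, testBit_mask]
  refine forall_congr' fun j => exists_congr fun b => (and_iff_right ?_).symm
  rw [Nat.testBit_two_pow_sub_one, decide_eq_true_eq]
  omega

theorem card_isConsistent : Nat.card {f : Fin 6 → Fin 12 // IsConsistent f} = 372 := by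
  have hcount : count mask (2 ^ 72 - 1) = 372 := by decide +kernel
  simp only [isConsistent_iff]
  rw [card_live_meet mask (by decide +kernel), hcount]

theorem isPreGCO_iff {σ : Finset ℕ → List ℕ} : IsPreGCO 3 (Finset.Icc 1 6) σ ↔
    ∀ i, (σ {label i}).Nodup ∧ (σ {label i}).toFinset = Finset.Icc 1 6 \ {label i} := by
  refine ⟨fun h i => h _ (by simpa using label_mem i) (by simp), fun h I hI hc => ?_⟩
  obtain ⟨x, rfl⟩ := Finset.card_eq_one.1 hc
  obtain ⟨i, rfl⟩ := exists_label_of_mem (hI (Finset.mem_singleton_self x))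
  exact h i

theorem isPseudoGCO_iff {σ : Finset ℕ → List ℕ} {f : Fin 6 → Fin 12}
    (hf : ∀ i, DihEquiv (σ {label i}) (word i (f i))) :
    IsPseudoGCO 3 (Finset.Icc 1 6) σ ↔ IsConsistent f := by
  have hcard (j : Fin 6) : ((Finset.Icc 1 6).erase (label j)).card ≤ 3 + 2 := by
    rw [Finset.card_erase_of_mem (label_mem j)]; simp
  rw [IsPseudoGCO, if_neg (by simp)]
  constructor
  · intro h j
    have hj := h _ (label_mem j)
    rw [IsPseudoGCO, if_pos (hcard j)] at hj
    obtain ⟨base, hnd, hbase, hres⟩ := hj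
    obtain ⟨b, hb⟩ := exists_dihEquiv_word hnd (hbase.trans (Finset.erase_eq _ _))
    refine ⟨b, fun i hij => ?_⟩
    have hi := hres {label i}
      (by simpa [label_injective.eq_iff, hij] using label_mem i) (by simp)
    simp only [Finset.mem_singleton] at hi
    exact dihEquiv_trans (dihEquiv_symm ((hf i).filter _)) (dihEquiv_trans hi (hb.filter _))
  · intro h x hx
    obtain ⟨j, rfl⟩ := exists_label_of_mem hx
    rw [IsPseudoGCO, if_pos (hcard j)]
    obtain ⟨b, hb⟩ := h j
    refine ⟨word j b, word_nodup j b, (word_toFinset j b).trans (Finset.erase_eq _ _).symm, ?_⟩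
    intro I hI hc
    obtain ⟨x, rfl⟩ := Finset.card_eq_one.1 hc
    obtain ⟨hne, hmem⟩ := Finset.mem_erase.1 (hI (Finset.mem_singleton_self x))
    obtain ⟨i, rfl⟩ := exists_label_of_mem hmem
    simp only [Finset.mem_singleton]
    exact dihEquiv_trans ((hf i).filter _) (hb i (ne_of_apply_ne label hne))

/-- The pre-GCO with components `word i (f i)`. -/
def ofIndices (f : Fin 6 → Fin 12) (I : Finset ℕ) : List ℕ :=
  let i := Fin.ofNat 6 (I.sum id - 1)
  word i (f i)

theorem ofIndices_label (f : Fin 6 → Fin 12) (i : Fin 6) :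
    ofIndices f {label i} = word i (f i) := by
  have : Fin.ofNat 6 (label i - 1) = i := by revert i; decide
  simp only [ofIndices, Finset.sum_singleton, id, this]

end SixLabels

open SixLabels in
/-- There are exactly 372 `(3,6)` pseudo-GCOs on the label set `{1, …, 6}`. -/
theorem card_pseudoGCO_three_six :
    Nat.card (Quotient (gcoSetoid 3 (Finset.Icc 1 6) (fun σ =>
        IsPreGCO 3 (Finset.Icc 1 6) σ ∧ IsPseudoGCO 3 (Finset.Icc 1 6) σ))) = 372 := by
  let toQuotient : {f // IsConsistent f} → Quotient (gcoSetoid 3 (Finset.Icc 1 6) (fun σ =>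
      IsPreGCO 3 (Finset.Icc 1 6) σ ∧ IsPseudoGCO 3 (Finset.Icc 1 6) σ)) := fun f =>
    ⟦⟨ofIndices f.1,
      isPreGCO_iff.2 fun i => by
        rw [ofIndices_label]; exact ⟨word_nodup _ _, word_toFinset _ _⟩,
      (isPseudoGCO_iff fun i => by rw [ofIndices_label]; exact dihEquiv_refl _).2 f.2⟩⟧
  have hbij : Function.Bijective toQuotient := by
    constructor
    · intro f g h
      refine Subtype.ext (funext fun i => eq_of_dihEquiv_word (i := i) ?_)
      have := Quotient.exact h {label i} (by simpa using label_mem i) (by simp)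
      simpa only [ofIndices_label] using this
    · intro q
      obtain ⟨⟨σ, hpre, hpseudo⟩, rfl⟩ := Quotient.exists_rep q
      choose f hf using fun i => exists_dihEquiv_word (isPreGCO_iff.1 hpre i).1
        (isPreGCO_iff.1 hpre i).2
      refine ⟨⟨f, (isPseudoGCO_iff hf).1 hpseudo⟩, Quotient.sound fun I hI hc => ?_⟩
      obtain ⟨x, rfl⟩ := Finset.card_eq_one.1 hc
      obtain ⟨i, rfl⟩ := exists_label_of_mem (hI (Finset.mem_singleton_self x))
      simpa only [ofIndices_label] using dihEquiv_symm (hf i)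
  rw [← Nat.card_congr (Equiv.ofBijective toQuotient hbij), card_isConsistent]
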